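/- Let Ω ⊆ ℂ³ be open and let ξ₁₂, ξ₁₃, ξ₂₃ : Ω → ℂ be of class C¹; extend to a skew-symmetric array ξ_{ij} for i,j ∈ {1,2,3} by ξ_{ji} = −ξ_{ij} and ξ_{ii} = 0. Define J : Ω → M₆(ℝ) pointwise by J = A·𝕁·A⁻¹, where A = A(ξ₁₂,ξ₁₃,ξ₂₃) is the matrix below evaluated at the point. Then the Nijenhuis tensor of J vanishes on Ω if and only if for all i,j,s ∈ {1,2,3}: ∂ξ_{ij}/∂z̄_s + Σ_{l=1}^{3} (∂ξ_{ij}/∂z_l)·ξ_{sl} = 0 identically on Ω. -/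

import Mathlib

open Matrix Filter

attribute [local instance] Matrix.normedAddCommGroup Matrix.normedSpace

/-- The Nijenhuis tensor of a matrix-valued map `J`. -/
noncomputable def nijenhuis {ι : Type*} [Fintype ι]
    (J : (ι → ℝ) → Matrix ι ι ℝ) (x v w : ι → ℝ) : ι → ℝ :=
  (fderiv ℝ J x ((J x).mulVec v)).mulVec w
    - (fderiv ℝ J x ((J x).mulVec w)).mulVec v
    + (J x).mulVec ((fderiv ℝ J x w).mulVec v)
    - (J x).mulVec ((fderiv ℝ J x v).mulVec w)

/-- The Wirtinger derivative `∂h/∂z_j = (∂h/∂x_j − i ∂h/∂y_j)/2` of `h : ℂ³ → ℂ`. -/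
noncomputable def wirtingerD (h : (Fin 3 → ℂ) → ℂ) (z : Fin 3 → ℂ) (j : Fin 3) : ℂ :=
  (1 / 2 : ℂ) * (fderiv ℝ h z (Pi.single j 1) - Complex.I * fderiv ℝ h z (Pi.single j Complex.I))

/-- The Wirtinger derivative `∂h/∂z̄_j = (∂h/∂x_j + i ∂h/∂y_j)/2` of `h : ℂ³ → ℂ`. -/
noncomputable def wirtingerDBar (h : (Fin 3 → ℂ) → ℂ) (z : Fin 3 → ℂ) (j : Fin 3) : ℂ :=
  (1 / 2 : ℂ) * (fderiv ℝ h z (Pi.single j 1) + Complex.I * fderiv ℝ h z (Pi.single j Complex.I))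

/-- The skew-symmetric array `ξ_{ij}` built from `ξ₁₂, ξ₁₃, ξ₂₃`. -/
def xiMat (a b c : ℂ) : Matrix (Fin 3) (Fin 3) ℂ :=
  !![0, a, b; -a, 0, c; -b, -c, 0]

/-- The real `6×6` matrix `A(ξ₁₂,ξ₁₃,ξ₂₃)` (with `ξ_{ij} = f_{ij} + i g_{ij}`). -/
def Amat (a b c : ℂ) : Matrix (Fin 6) (Fin 6) ℝ :=
  !![-1, 0, a.re, a.im, b.re, b.im;
     0, -1, a.im, -a.re, b.im, -b.re;
     -a.re, -a.im, -1, 0, c.re, c.im;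
     -a.im, a.re, 0, -1, c.im, -c.re;
     -b.re, -b.im, -c.re, -c.im, -1, 0;
     -b.im, b.re, -c.im, c.re, 0, -1]

/-- The standard complex structure `𝕁 = blockdiag(J₀,J₀,J₀)` on `ℝ⁶`. -/
def stdJ : Matrix (Fin 6) (Fin 6) ℝ :=
  !![0, -1, 0, 0, 0, 0;
     1, 0, 0, 0, 0, 0;
     0, 0, 0, -1, 0, 0;
     0, 0, 1, 0, 0, 0;
     0, 0, 0, 0, 0, -1;
     0, 0, 0, 0, 1, 0]

/-- The identification `ℝ⁶ = ℂ³`, `z_j = x_j + i y_j`, real coordinates ordered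
`(x₁,y₁,x₂,y₂,x₃,y₃)`. -/
noncomputable def toC3 (p : Fin 6 → ℝ) : Fin 3 → ℂ :=
  ![(p 0 : ℂ) + (p 1 : ℂ) * Complex.I,
    (p 2 : ℂ) + (p 3 : ℂ) * Complex.I,
    (p 4 : ℂ) + (p 5 : ℂ) * Complex.I]

/-- The almost complex structure `J = A·𝕁·A⁻¹` determined by `ξ₁₂, ξ₁₃, ξ₂₃ : ℂ³ → ℂ`. -/
noncomputable def Jxi (ξ12 ξ13 ξ23 : (Fin 3 → ℂ) → ℂ) (p : Fin 6 → ℝ) :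
    Matrix (Fin 6) (Fin 6) ℝ :=
  Amat (ξ12 (toC3 p)) (ξ13 (toC3 p)) (ξ23 (toC3 p)) * stdJ *
    (Amat (ξ12 (toC3 p)) (ξ13 (toC3 p)) (ξ23 (toC3 p)))⁻¹

open ComplexConjugate

theorem Amat_mul_stdJ (a b c : ℂ) : Amat a b c * stdJ = stdJ * (Amat a b c)ᵀ := by
  ext i j
  fin_cases i <;> fin_cases j <;> simp [Amat, stdJ, Matrix.mul_apply, Fin.sum_univ_six]

theorem Amat_add_transpose (a b c : ℂ) :
    Amat a b c + (Amat a b c)ᵀ = -(2 : ℝ) • (1 : Matrix (Fin 6) (Fin 6) ℝ) := by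
  ext i j
  fin_cases i <;> fin_cases j <;> simp [Amat] <;> norm_num

theorem stdJ_mul_stdJ : stdJ * stdJ = -1 := by
  ext i j
  fin_cases i <;> fin_cases j <;> simp [stdJ, Matrix.mul_apply, Fin.sum_univ_six]

/-- The kernel of `-1 + B` with `B` skew-symmetric is trivial. -/
theorem isUnit_det_Amat (a b c : ℂ) : IsUnit (Amat a b c).det := by
  rw [isUnit_iff_ne_zero]
  intro h
  obtain ⟨v, hv, hAv⟩ := Matrix.exists_mulVec_eq_zero_iff.mpr h
  apply hv
  have h1 : v ⬝ᵥ (Amat a b c *ᵥ v) = 0 := by simp [hAv]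
  have h2 : v ⬝ᵥ ((Amat a b c)ᵀ *ᵥ v) = 0 := by
    rw [Matrix.dotProduct_mulVec, Matrix.vecMul_transpose, hAv, zero_dotProduct]
  have h3 : v ⬝ᵥ ((Amat a b c + (Amat a b c)ᵀ) *ᵥ v) = 0 := by
    rw [Matrix.add_mulVec, dotProduct_add, h1, h2, add_zero]
  rw [Amat_add_transpose, Matrix.smul_mulVec, Matrix.one_mulVec, dotProduct_smul] at h3
  exact dotProduct_self_eq_zero.mp (by simpa using h3)

/-- The antilinear part `v ↦ ξ v̄` of `Amat`, as a real matrix. -/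
def skewPart (a b c : ℂ) : Matrix (Fin 6) (Fin 6) ℝ := Amat a b c + 1

theorem skewPart_mul_stdJ (a b c : ℂ) :
    skewPart a b c * stdJ = -(stdJ * skewPart a b c) := by
  have hT : (Amat a b c)ᵀ = -(2 : ℝ) • (1 : Matrix (Fin 6) (Fin 6) ℝ) - Amat a b c := by
    rw [← Amat_add_transpose a b c]
    abel
  rw [skewPart, Matrix.add_mul, Amat_mul_stdJ, hT, Matrix.mul_sub, Matrix.mul_add,
    Matrix.mul_smul, Matrix.one_mul, Matrix.mul_one]
  module

/-- `toC3` as a continuous linear map. -/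
noncomputable def toC3CLM : (Fin 6 → ℝ) →L[ℝ] (Fin 3 → ℂ) :=
  LinearMap.toContinuousLinearMap
    { toFun := toC3
      map_add' := fun p q => by
        ext i
        fin_cases i <;> simp [toC3] <;> ring
      map_smul' := fun r p => by
        ext i
        fin_cases i <;> simp [toC3] <;> ring }

@[simp]
theorem toC3CLM_apply (p : Fin 6 → ℝ) : toC3CLM p = toC3 p := rfl

theorem toC3_surjective : Function.Surjective toC3 := fun z =>
  ⟨![(z 0).re, (z 0).im, (z 1).re, (z 1).im, (z 2).re, (z 2).im], by
    ext i
    fin_cases i <;> simp [toC3]⟩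

theorem toC3_injective : Function.Injective toC3 := fun p q h => by
  have h0 := congrFun h 0
  have h1 := congrFun h 1
  have h2 := congrFun h 2
  simp [toC3, Complex.ext_iff] at h0 h1 h2
  ext i
  fin_cases i <;> simp [h0, h1, h2]

theorem toC3_sub (p q : Fin 6 → ℝ) : toC3 (p - q) = toC3 p - toC3 q :=
  map_sub toC3CLM p q

theorem toC3_stdJ_mulVec (v : Fin 6 → ℝ) : toC3 (stdJ *ᵥ v) = Complex.I • toC3 v := by
  ext i
  fin_cases i <;>
    simp [toC3, stdJ, Matrix.mulVec, dotProduct, Fin.sum_univ_six, Complex.ext_iff]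

theorem toC3_skewPart_mulVec (a b c : ℂ) (v : Fin 6 → ℝ) :
    toC3 (skewPart a b c *ᵥ v) = xiMat a b c *ᵥ star (toC3 v) := by
  ext i
  fin_cases i <;>
    simp [toC3, skewPart, Amat, xiMat, Matrix.mulVec, dotProduct, Fin.sum_univ_six,
      Fin.sum_univ_three, Complex.ext_iff] <;> constructor <;> ring

theorem toC3_Amat_mulVec (a b c : ℂ) (v : Fin 6 → ℝ) :
    toC3 (Amat a b c *ᵥ v) = xiMat a b c *ᵥ star (toC3 v) - toC3 v := by
  rw [← toC3_skewPart_mulVec, ← toC3_sub, skewPart, Matrix.add_mulVec, Matrix.one_mulVec,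
    add_sub_cancel_right]

theorem xiMat_swap (a b c : ℂ) (i j : Fin 3) : xiMat a b c i j = -xiMat a b c j i := by
  fin_cases i <;> fin_cases j <;> simp [xiMat]

theorem Jxi_mul_Amat (ξ12 ξ13 ξ23 : (Fin 3 → ℂ) → ℂ) (p : Fin 6 → ℝ) :
    Jxi ξ12 ξ13 ξ23 p * Amat (ξ12 (toC3 p)) (ξ13 (toC3 p)) (ξ23 (toC3 p)) =
      Amat (ξ12 (toC3 p)) (ξ13 (toC3 p)) (ξ23 (toC3 p)) * stdJ := by
  rw [Jxi, Matrix.mul_assoc, Matrix.nonsing_inv_mul _ (isUnit_det_Amat _ _ _), Matrix.mul_one]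

theorem Jxi_mul_self (ξ12 ξ13 ξ23 : (Fin 3 → ℂ) → ℂ) (p : Fin 6 → ℝ) :
    Jxi ξ12 ξ13 ξ23 p * Jxi ξ12 ξ13 ξ23 p = -1 := by
  have h := Jxi_mul_Amat ξ12 ξ13 ξ23 p
  nth_rewrite 2 [Jxi]
  rw [← Matrix.mul_assoc, ← Matrix.mul_assoc, h, Matrix.mul_assoc _ stdJ stdJ, stdJ_mul_stdJ]
  simp [Matrix.mul_nonsing_inv _ (isUnit_det_Amat _ _ _)]

/-- The Nijenhuis tensor in the frame `A`, where `D` is the derivative of `A`. -/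
theorem nijenhuis_mulVec {ι : Type*} [Fintype ι] [DecidableEq ι]
    {J : (ι → ℝ) → Matrix ι ι ℝ} {p : ι → ℝ} {A S : Matrix ι ι ℝ} {D : (ι → ℝ) → Matrix ι ι ℝ}
    (hJA : J p * A = A * S) (hJ : J p * J p = -1) (hS : S * S = -1)
    (hDS : ∀ u, D u * S = -(S * D u))
    (hD : ∀ u, fderiv ℝ J p u * A = D u * S - J p * D u) (a b : ι → ℝ) :
    nijenhuis J p (A *ᵥ a) (A *ᵥ b) =
      (1 - J p * S) *ᵥ
        ((D (A *ᵥ S *ᵥ a) *ᵥ S *ᵥ b - D (A *ᵥ a) *ᵥ b)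
          - (D (A *ᵥ S *ᵥ b) *ᵥ S *ᵥ a - D (A *ᵥ b) *ᵥ a)) := by
  have e1 : ∀ v, J p *ᵥ A *ᵥ v = A *ᵥ S *ᵥ v := fun v => by
    rw [Matrix.mulVec_mulVec, hJA, Matrix.mulVec_mulVec]
  have e2 : ∀ v, J p *ᵥ J p *ᵥ v = -v := fun v => by
    rw [Matrix.mulVec_mulVec, hJ, Matrix.neg_mulVec, Matrix.one_mulVec]
  have e3 : ∀ v, S *ᵥ S *ᵥ v = -v := fun v => by
    rw [Matrix.mulVec_mulVec, hS, Matrix.neg_mulVec, Matrix.one_mulVec]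
  have e4 : ∀ u v, S *ᵥ D u *ᵥ v = -(D u *ᵥ S *ᵥ v) := fun u v => by
    rw [Matrix.mulVec_mulVec, Matrix.mulVec_mulVec, hDS, Matrix.neg_mulVec, neg_neg]
  have e5 : ∀ u v, fderiv ℝ J p u *ᵥ A *ᵥ v = D u *ᵥ S *ᵥ v - J p *ᵥ D u *ᵥ v := fun u v => by
    rw [Matrix.mulVec_mulVec, hD, Matrix.sub_mulVec, Matrix.mulVec_mulVec, Matrix.mulVec_mulVec]
  simp only [nijenhuis, e1, e5, Matrix.sub_mulVec, Matrix.one_mulVec, ← Matrix.mulVec_mulVec,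
    Matrix.mulVec_sub, e2, e3, e4, Matrix.mulVec_neg]
  abel

theorem one_sub_mul_mulVec_eq_zero {ι : Type*} [Fintype ι] [DecidableEq ι]
    {J A S : Matrix ι ι ℝ} (hJA : J * A = A * S) (hJ : J * J = -1)
    (hAS : A * S = S * Aᵀ) (hA : A + Aᵀ = -(2 : ℝ) • (1 : Matrix ι ι ℝ)) (hdet : IsUnit A.det)
    {q : ι → ℝ} (hq : (1 - J * S) *ᵥ q = 0) : q = 0 := by
  have hdet' : IsUnit (Aᵀ).det := by rwa [Matrix.det_transpose]
  have hT : Aᵀ = -(2 : ℝ) • (1 : Matrix ι ι ℝ) - A := by rw [← hA]; abel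
  have h1 : (1 - J * S) * Aᵀ = -(2 : ℝ) • (1 : Matrix ι ι ℝ) := by
    rw [Matrix.sub_mul, Matrix.one_mul, Matrix.mul_assoc, ← hAS, ← hJA, ← Matrix.mul_assoc, hJ,
      Matrix.neg_mul, Matrix.one_mul, sub_neg_eq_add, add_comm, hA]
  have h2 : q = Aᵀ *ᵥ ((Aᵀ)⁻¹ *ᵥ q) := by
    rw [Matrix.mulVec_mulVec, Matrix.mul_nonsing_inv _ hdet', Matrix.one_mulVec]
  rw [h2, Matrix.mulVec_mulVec, h1, Matrix.smul_mulVec, Matrix.one_mulVec] at hq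
  have h3 : (Aᵀ)⁻¹ *ᵥ q = 0 := by simpa using hq
  rw [h2, h3, Matrix.mulVec_zero]

theorem fderiv_eq_wirtinger (h : (Fin 3 → ℂ) → ℂ) (z u : Fin 3 → ℂ) :
    fderiv ℝ h z u =
      ∑ l, (wirtingerD h z l * u l + wirtingerDBar h z l * conj (u l)) := by
  have hu : u = ∑ l, ((u l).re • (Pi.single l 1 : Fin 3 → ℂ) +
      (u l).im • (Pi.single l Complex.I : Fin 3 → ℂ)) := by
    ext k
    simp [Finset.sum_apply, Pi.single_apply, Finset.sum_add_distrib]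
  conv_lhs => rw [hu]
  rw [map_sum]
  refine Finset.sum_congr rfl fun l _ => ?_
  rw [map_add, map_smul, map_smul, wirtingerD, wirtingerDBar]
  generalize fderiv ℝ h z (Pi.single l 1) = α
  generalize fderiv ℝ h z (Pi.single l Complex.I) = β
  apply Complex.ext <;> simp <;> ring

theorem differentiableAt_matrix_iff {E : Type*} [NormedAddCommGroup E] [NormedSpace ℝ E]
    {m n : Type*} [Fintype m] [Fintype n] {F : E → Matrix m n ℝ} {x : E} :
    DifferentiableAt ℝ F x ↔ ∀ i j, DifferentiableAt ℝ (fun y => F y i j) x := by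
  refine (differentiableAt_pi (Φ := F)).trans (forall_congr' fun i => ?_)
  exact differentiableAt_pi (Φ := fun y => F y i)

theorem fderiv_matrix_apply {E : Type*} [NormedAddCommGroup E] [NormedSpace ℝ E]
    {m n : Type*} [Fintype m] [Fintype n] {F : E → Matrix m n ℝ} {x : E}
    (hF : DifferentiableAt ℝ F x) (u : E) (i : m) (j : n) :
    fderiv ℝ F x u i j = fderiv ℝ (fun y => F y i j) x u := by
  have h1 := hasFDerivAt_pi'.mp (hasFDerivAt_pi'.mp (show HasFDerivAt (F : E → m → n → ℝ) _ x from
    hF.hasFDerivAt) i) j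
  exact congrArg (fun L : E →L[ℝ] ℝ => L u) h1.fderiv.symm

theorem DifferentiableAt.matrix_mul {E : Type*} [NormedAddCommGroup E] [NormedSpace ℝ E]
    {l m n : Type*} [Fintype l] [Fintype m] [Fintype n]
    {F : E → Matrix l m ℝ} {G : E → Matrix m n ℝ} {x : E}
    (hF : DifferentiableAt ℝ F x) (hG : DifferentiableAt ℝ G x) :
    DifferentiableAt ℝ (fun y => F y * G y) x := by
  have hF' := differentiableAt_matrix_iff.mp hF
  have hG' := differentiableAt_matrix_iff.mp hG
  refine differentiableAt_matrix_iff.mpr fun i j => ?_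
  simp only [Matrix.mul_apply]
  exact DifferentiableAt.fun_sum fun k _ => (hF' i k).mul (hG' k j)

theorem fderiv_matrix_mul {E : Type*} [NormedAddCommGroup E] [NormedSpace ℝ E]
    {l m n : Type*} [Fintype l] [Fintype m] [Fintype n]
    {F : E → Matrix l m ℝ} {G : E → Matrix m n ℝ} {x : E}
    (hF : DifferentiableAt ℝ F x) (hG : DifferentiableAt ℝ G x) (u : E) :
    fderiv ℝ (fun y => F y * G y) x u = fderiv ℝ F x u * G x + F x * fderiv ℝ G x u := by
  have hF' := differentiableAt_matrix_iff.mp hF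
  have hG' := differentiableAt_matrix_iff.mp hG
  ext i j
  have h := HasFDerivAt.fun_sum (u := Finset.univ) fun k _ =>
    (hF' i k).hasFDerivAt.fun_mul (hG' k j).hasFDerivAt
  rw [fderiv_matrix_apply (hF.matrix_mul hG)]
  simp only [Matrix.mul_apply, Matrix.add_apply, fderiv_matrix_apply hF, fderiv_matrix_apply hG]
  rw [h.fderiv]
  simp [← Finset.sum_add_distrib, add_comm, mul_comm]

theorem DifferentiableAt.matrix_det {E : Type*} [NormedAddCommGroup E] [NormedSpace ℝ E]
    {n : Type*} [Fintype n] [DecidableEq n] {F : E → Matrix n n ℝ} {x : E}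
    (hF : DifferentiableAt ℝ F x) : DifferentiableAt ℝ (fun y => (F y).det) x := by
  have hF' := differentiableAt_matrix_iff.mp hF
  simp only [Matrix.det_apply']
  fun_prop

theorem DifferentiableAt.matrix_inv {E : Type*} [NormedAddCommGroup E] [NormedSpace ℝ E]
    {n : Type*} [Fintype n] [DecidableEq n] {F : E → Matrix n n ℝ} {x : E}
    (hF : DifferentiableAt ℝ F x) (hx : IsUnit (F x).det) :
    DifferentiableAt ℝ (fun y => (F y)⁻¹) x := by
  have hF' := differentiableAt_matrix_iff.mp hF
  refine differentiableAt_matrix_iff.mpr fun i j => ?_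
  simp only [Matrix.inv_def, Matrix.smul_apply, Matrix.adjugate_apply, Ring.inverse_eq_inv',
    smul_eq_mul]
  refine (hF.matrix_det.inv hx.ne_zero).mul (DifferentiableAt.matrix_det ?_)
  refine differentiableAt_matrix_iff.mpr fun k l => ?_
  by_cases hk : k = j
  · simp [hk]
  · simpa [Matrix.updateRow_apply, hk] using hF' k l

/-- `skewPart` as a continuous linear map. -/
noncomputable def skewPartCLM : ℂ × ℂ × ℂ →L[ℝ] Matrix (Fin 6) (Fin 6) ℝ :=
  LinearMap.toContinuousLinearMap
    { toFun := fun q => skewPart q.1 q.2.1 q.2.2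
      map_add' := fun q r => by
        ext i j
        fin_cases i <;> fin_cases j <;> simp [skewPart, Amat, add_comm]
      map_smul' := fun t q => by
        ext i j
        fin_cases i <;> fin_cases j <;> simp [skewPart, Amat] }

theorem hasFDerivAt_Amat {E : Type*} [NormedAddCommGroup E] [NormedSpace ℝ E]
    {f g h : E → ℂ} {f' g' h' : E →L[ℝ] ℂ} {x : E} (hf : HasFDerivAt f f' x)
    (hg : HasFDerivAt g g' x) (hh : HasFDerivAt h h' x) :
    HasFDerivAt (fun y => Amat (f y) (g y) (h y)) (skewPartCLM.comp (f'.prod (g'.prod h'))) x := by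
  have hA : (fun y => Amat (f y) (g y) (h y)) =
      fun y => skewPartCLM (f y, g y, h y) - 1 := funext fun y =>
    (add_sub_cancel_right (Amat (f y) (g y) (h y)) 1).symm
  rw [hA]
  exact (skewPartCLM.hasFDerivAt.comp x (hf.prodMk (hg.prodMk hh))).sub_const 1

/-- The left-hand side of the integrability equations for `ξ_{ij}` in the direction `s`. -/
noncomputable def integrabilityDefect (ξ12 ξ13 ξ23 : (Fin 3 → ℂ) → ℂ) (z : Fin 3 → ℂ)
    (i j s : Fin 3) : ℂ :=
  wirtingerDBar (fun w => xiMat (ξ12 w) (ξ13 w) (ξ23 w) i j) z s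
    + ∑ l : Fin 3, wirtingerD (fun w => xiMat (ξ12 w) (ξ13 w) (ξ23 w) i j) z l
        * xiMat (ξ12 z) (ξ13 z) (ξ23 z) s l

theorem integrabilityDefect_swap (ξ12 ξ13 ξ23 : (Fin 3 → ℂ) → ℂ) (z : Fin 3 → ℂ)
    (i j s : Fin 3) :
    integrabilityDefect ξ12 ξ13 ξ23 z i j s = -integrabilityDefect ξ12 ξ13 ξ23 z j i s := by
  have h : (fun w => xiMat (ξ12 w) (ξ13 w) (ξ23 w) i j) =
      -fun w => xiMat (ξ12 w) (ξ13 w) (ξ23 w) j i := funext fun w => xiMat_swap _ _ _ i j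
  simp only [integrabilityDefect, h, wirtingerD, wirtingerDBar, fderiv_neg,
    _root_.neg_apply, Fin.sum_univ_three]
  ring

/-- A three-index array symmetric in one pair of indices and skew in an overlapping one
vanishes. -/
theorem eq_zero_of_symm_of_skew {α : Type*} {Z : α → α → α → ℂ}
    (hsymm : ∀ i j s, Z i j s = Z i s j) (hskew : ∀ i j s, Z i j s = -Z j i s) (i j s : α) :
    Z i j s = 0 := by
  have h : Z i j s = -Z i j s := by
    calc Z i j s = -Z j i s := hskew i j s
      _ = -Z j s i := by rw [hsymm j i s]
      _ = Z s j i := by rw [hskew s j i]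
      _ = Z s i j := hsymm s j i
      _ = -Z i s j := hskew s i j
      _ = -Z i j s := by rw [hsymm i j s]
  exact self_eq_neg.mp h

theorem fderiv_xiMat {ξ12 ξ13 ξ23 : (Fin 3 → ℂ) → ℂ} (z u : Fin 3 → ℂ) (i j : Fin 3) :
    xiMat (fderiv ℝ ξ12 z u) (fderiv ℝ ξ13 z u) (fderiv ℝ ξ23 z u) i j =
      fderiv ℝ (fun w => xiMat (ξ12 w) (ξ13 w) (ξ23 w) i j) z u := by
  fin_cases i <;> fin_cases j <;> simp [xiMat]

theorem toC3_frame_apply (ξ12 ξ13 ξ23 : (Fin 3 → ℂ) → ℂ) (z : Fin 3 → ℂ) (a b : Fin 6 → ℝ)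
    (i : Fin 3) :
    let A := Amat (ξ12 z) (ξ13 z) (ξ23 z)
    let D := fun u => skewPart (fderiv ℝ ξ12 z (toC3 u)) (fderiv ℝ ξ13 z (toC3 u))
      (fderiv ℝ ξ23 z (toC3 u))
    toC3 (D (A *ᵥ stdJ *ᵥ a) *ᵥ stdJ *ᵥ b - D (A *ᵥ a) *ᵥ b) i =
      2 * ∑ j, ∑ s, integrabilityDefect ξ12 ξ13 ξ23 z i j s *
        (conj (toC3 a s) * conj (toC3 b j)) := by
  intro A D
  simp only [A, D, toC3_sub, toC3_skewPart_mulVec, toC3_Amat_mulVec, toC3_stdJ_mulVec]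
  generalize toC3 a = α
  generalize toC3 b = β
  simp only [Pi.sub_apply, Matrix.mulVec, dotProduct, fderiv_xiMat]
  rw [← Finset.sum_sub_distrib, Finset.mul_sum]
  refine Finset.sum_congr rfl fun j _ => ?_
  simp only [fderiv_eq_wirtinger, integrabilityDefect]
  generalize wirtingerD _ z = d
  generalize wirtingerDBar _ z = e
  have hstar : star α = fun l => conj (α l) := rfl
  simp [Fin.sum_univ_three, xiMat, hstar, vecHead, vecTail]
  ring_nf
  simp only [Complex.I_sq]
  ring

theorem nijenhuis_Jxi_eq_zero_iff {ξ12 ξ13 ξ23 : (Fin 3 → ℂ) → ℂ} {p : Fin 6 → ℝ}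
    (h12 : DifferentiableAt ℝ ξ12 (toC3 p)) (h13 : DifferentiableAt ℝ ξ13 (toC3 p))
    (h23 : DifferentiableAt ℝ ξ23 (toC3 p)) :
    (∀ v w, nijenhuis (Jxi ξ12 ξ13 ξ23) p v w = 0) ↔
      ∀ i j s, integrabilityDefect ξ12 ξ13 ξ23 (toC3 p) i j s = 0 := by
  set A := Amat (ξ12 (toC3 p)) (ξ13 (toC3 p)) (ξ23 (toC3 p)) with hAdef
  have hcomp : ∀ {k : (Fin 3 → ℂ) → ℂ}, DifferentiableAt ℝ k (toC3 p) →
      HasFDerivAt (fun q => k (toC3 q)) ((fderiv ℝ k (toC3 p)).comp toC3CLM) p := fun hk =>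
    HasFDerivAt.comp (f := toC3) p hk.hasFDerivAt toC3CLM.hasFDerivAt
  have hA' := hasFDerivAt_Amat (hcomp h12) (hcomp h13) (hcomp h23)
  have hA := hA'.differentiableAt
  have hdet : IsUnit A.det := isUnit_det_Amat _ _ _
  have hJ : DifferentiableAt ℝ (Jxi ξ12 ξ13 ξ23) p :=
    (hA.matrix_mul (differentiableAt_const stdJ)).matrix_mul (hA.matrix_inv hdet)
  have hJA := Jxi_mul_Amat ξ12 ξ13 ξ23 p
  have hJJ := Jxi_mul_self ξ12 ξ13 ξ23 p
  have hD : ∀ u, fderiv ℝ (Jxi ξ12 ξ13 ξ23) p u * A =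
      skewPart (fderiv ℝ ξ12 (toC3 p) (toC3 u)) (fderiv ℝ ξ13 (toC3 p) (toC3 u))
        (fderiv ℝ ξ23 (toC3 p) (toC3 u)) * stdJ - Jxi ξ12 ξ13 ξ23 p *
      skewPart (fderiv ℝ ξ12 (toC3 p) (toC3 u)) (fderiv ℝ ξ13 (toC3 p) (toC3 u))
        (fderiv ℝ ξ23 (toC3 p) (toC3 u)) := fun u => by
    have h1 := fderiv_matrix_mul hJ hA u
    have h2 := fderiv_matrix_mul hA (differentiableAt_const stdJ) u
    simp only [Jxi_mul_Amat] at h1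
    rw [h1, hA'.fderiv] at h2
    rw [eq_sub_iff_add_eq]
    simpa [skewPartCLM] using h2
  have key := nijenhuis_mulVec hJA hJJ stdJ_mul_stdJ (fun u => skewPart_mul_stdJ _ _ _) hD
  rw [← hAdef] at key
  have hsurj : ∀ v, ∃ a, A *ᵥ a = v := fun v => ⟨A⁻¹ *ᵥ v, by
    rw [Matrix.mulVec_mulVec, Matrix.mul_nonsing_inv _ hdet, Matrix.one_mulVec]⟩
  constructor
  · intro hN
    refine eq_zero_of_symm_of_skew (fun i j s => ?_)
      (integrabilityDefect_swap ξ12 ξ13 ξ23 (toC3 p))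
    obtain ⟨a, ha⟩ := toC3_surjective (Pi.single s 1)
    obtain ⟨b, hb⟩ := toC3_surjective (Pi.single j 1)
    have h := one_sub_mul_mulVec_eq_zero hJA hJJ (Amat_mul_stdJ _ _ _)
      (Amat_add_transpose _ _ _) hdet ((key a b).symm.trans (hN _ _))
    have h' := congrFun (congrArg toC3 (sub_eq_zero.mp h)) i
    rw [toC3_frame_apply, toC3_frame_apply, ha, hb] at h'
    simpa [Pi.single_apply, apply_ite conj] using h'
  · intro hZ v w
    obtain ⟨a, rfl⟩ := hsurj v
    obtain ⟨b, rfl⟩ := hsurj w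
    rw [key]
    refine (congrArg _ (sub_eq_zero.mpr (toC3_injective (funext fun i => ?_)))).trans
      (Matrix.mulVec_zero _)
    rw [toC3_frame_apply, toC3_frame_apply]
    simp [hZ]

/-- **Integrability equations for orthogonal almost complex structures on domains of `ℂ³`.**
The Nijenhuis tensor of `J = A·𝕁·A⁻¹` vanishes on `Ω` if and only if
`∂ξ_{ij}/∂z̄_s + Σ_l (∂ξ_{ij}/∂z_l)·ξ_{sl} = 0` on `Ω` for all `i,j,s`. -/
theorem integrability_equations (Ω : Set (Fin 3 → ℂ)) (hΩ : IsOpen Ω)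
    (ξ12 ξ13 ξ23 : (Fin 3 → ℂ) → ℂ)
    (h12 : ContDiffOn ℝ 1 ξ12 Ω) (h13 : ContDiffOn ℝ 1 ξ13 Ω) (h23 : ContDiffOn ℝ 1 ξ23 Ω) :
    (∀ p : Fin 6 → ℝ, toC3 p ∈ Ω → ∀ v w : Fin 6 → ℝ,
        nijenhuis (Jxi ξ12 ξ13 ξ23) p v w = 0)
      ↔ (∀ (i j s : Fin 3), ∀ z ∈ Ω,
          wirtingerDBar (fun w => xiMat (ξ12 w) (ξ13 w) (ξ23 w) i j) z s
            + ∑ l : Fin 3, wirtingerD (fun w => xiMat (ξ12 w) (ξ13 w) (ξ23 w) i j) z l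
                * xiMat (ξ12 z) (ξ13 z) (ξ23 z) s l = 0) := by
  have hd : ∀ {k : (Fin 3 → ℂ) → ℂ}, ContDiffOn ℝ 1 k Ω → ∀ z ∈ Ω, DifferentiableAt ℝ k z :=
    fun hk z hz => (hk.differentiableOn one_ne_zero).differentiableAt (hΩ.mem_nhds hz)
  have hiff := fun p hp => nijenhuis_Jxi_eq_zero_iff (p := p) (hd h12 _ hp) (hd h13 _ hp)
    (hd h23 _ hp)
  constructor
  · intro hN i j s z hz
    obtain ⟨p, rfl⟩ := toC3_surjective z
    exact (hiff p hz).mp (hN p hz) i j s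
  · intro hZ p hp
    exact (hiff p hp).mpr fun i j s => hZ i j s _ hp
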